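/- Fractional feasibility of the adjusted Randomized Candidate Filtering mechanism for m identical items: let 1 ≤ m < n, let v_1,…,v_n be d-self-bounding valuation functions and s a signal profile with v_i(s) > 0 for all i and low_j^i := inf_{o_i ∈ S_i} v_j(o_i, s_{-i}) > 0 for all i, j. Then the expected number of candidates satisfies ∑_{i=1}^n E_{r,π}[c_i] ≤ 4m(d+1); consequently the allocation probabilities x_i := E_{r,π}[c_i] / (4(d+1)) satisfy ∑_{i=1}^n x_i ≤ m. -/

import Mathlib

open MeasureTheory Finset

/-- Lower estimate of valuation `v` with respect to bidder `i` at profile `s`: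
`low_i(v,s) = inf_{o_i ∈ S_i} v(o_i, s_{-i})`. -/
noncomputable def lowEst {n : ℕ} {S : Fin n → Type*} [∀ i, Nonempty (S i)]
    (v : ((i : Fin n) → S i) → ℝ) (s : (i : Fin n) → S i) (i : Fin n) : ℝ :=
  sInf (Set.range fun o : S i => v (Function.update s i o))

/-- Random rounding-down function: `f_r(w) = 2^(r+k)` for the unique `k ∈ ℤ` with
`2^(r+k) ≤ w < 2^(r+k+1)`. -/
noncomputable def fr (r w : ℝ) : ℝ := (2 : ℝ) ^ (r + (⌊Real.logb 2 w - r⌋ : ℝ))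

/-- Lexicographic tie-breaking: `a >_π b`, where `a` is associated with bidder `i`
and `b` with bidder `j`, holds if `a > b`, or `a = b` and `π(i) > π(j)`. -/
def lexGt {n : ℕ} (π : Equiv.Perm (Fin n)) (i j : Fin n) (a b : ℝ) : Prop :=
  b < a ∨ (a = b ∧ π j < π i)

noncomputable instance {n : ℕ} (π : Equiv.Perm (Fin n)) (i j : Fin n) (a b : ℝ) :
    Decidable (lexGt π i j a b) := by unfold lexGt; infer_instance

/-- In the adjusted (multi-unit) mechanism, bidder `i` is a candidate (for random
seed `r` and tie-breaking permutation `π`) if `f_r(v_i(s)) >_π f_r(low_j^i)` holds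
for at least `n - m` of the bidders `j ≠ i`. -/
def IsCandidateMulti {n : ℕ} {S : Fin n → Type*} [∀ i, Nonempty (S i)]
    (m : ℕ) (v : Fin n → ((i : Fin n) → S i) → ℝ) (s : (i : Fin n) → S i)
    (r : ℝ) (π : Equiv.Perm (Fin n)) (i : Fin n) : Prop :=
  n - m ≤ (Finset.univ.filter (fun j : Fin n =>
    j ≠ i ∧ lexGt π i j (fr r (v i s)) (fr r (lowEst (v j) s i)))).card

noncomputable instance {n : ℕ} {S : Fin n → Type*} [∀ i, Nonempty (S i)]
    (m : ℕ) (v : Fin n → ((i : Fin n) → S i) → ℝ) (s : (i : Fin n) → S i)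
    (r : ℝ) (π : Equiv.Perm (Fin n)) (i : Fin n) :
    Decidable (IsCandidateMulti m v s r π i) := by unfold IsCandidateMulti; infer_instance

/-- `E_{r,π}[c_i]` for the adjusted mechanism: the probability that bidder `i` is a
candidate, with `r` uniform on `[0,1)` and `π` uniform over all `n!` permutations. -/
noncomputable def EcandMulti {n : ℕ} {S : Fin n → Type*} [∀ i, Nonempty (S i)]
    (m : ℕ) (v : Fin n → ((i : Fin n) → S i) → ℝ) (s : (i : Fin n) → S i) (i : Fin n) : ℝ :=
  (n.factorial : ℝ)⁻¹ * ∑ π : Equiv.Perm (Fin n),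
    (volume {r ∈ Set.Ico (0:ℝ) 1 | IsCandidateMulti m v s r π i}).toReal

/-- Charging weights by position: the first `m` positions have weight `1`, later ones are
the increments of `-m / p`. -/
noncomputable def chargeWeight (m p : ℕ) : ℝ :=
  if p < m then 1 else (m : ℝ) / (p * (p + 1))

theorem chargeWeight_nonneg (m p : ℕ) : 0 ≤ chargeWeight m p := by
  unfold chargeWeight
  split_ifs <;> positivity

theorem sum_range_chargeWeight_le {m : ℕ} (hm : 1 ≤ m) {n : ℕ} (hmn : m ≤ n) :
    ∑ p ∈ range n, chargeWeight m p ≤ m + 1 - m / n := by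
  have hm0 : (0 : ℝ) < m := by exact_mod_cast hm
  induction n, hmn using Nat.le_induction with
  | base =>
    rw [sum_congr rfl (g := fun _ => (1 : ℝ))
      (fun p hp => by simp [chargeWeight, mem_range.1 hp])]
    simp [hm0.ne']
  | succ k hk ih =>
    rw [sum_range_succ]
    have hk0 : (0 : ℝ) < k := by exact_mod_cast lt_of_lt_of_le hm hk
    have : chargeWeight m k = m / k - m / (k + 1 : ℕ) := by
      rw [chargeWeight, if_neg (by omega)]
      push_cast
      field_simp
      ring
    linarith

theorem div_card_compl_le {m : ℕ} (hm : 1 ≤ m) (N : ℕ) (hN : m ≤ N) (L : Finset ℕ)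
    (hL : L ⊆ Ico m N) :
    (m : ℝ) / ((N : ℝ) - #L) ≤ m / N + ∑ p ∈ L, chargeWeight m p := by
  have hm0 : (0 : ℝ) < m := by exact_mod_cast hm
  induction N, hN using Nat.le_induction generalizing L with
  | base =>
    have : L = ∅ := by simpa using hL
    simp [this]
  | succ k hk ih =>
    have hk0 : (0 : ℝ) < k := by exact_mod_cast lt_of_lt_of_le hm hk
    by_cases hkL : k ∈ L
    · have hsub : L.erase k ⊆ Ico m k := by
        intro p hp
        have h1 := mem_Ico.1 (hL (mem_of_mem_erase hp))
        have h2 := ne_of_mem_erase hp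
        exact mem_Ico.2 ⟨h1.1, by omega⟩
      have h := ih _ hsub
      have hc : (#L : ℝ) = #(L.erase k) + 1 := by
        exact_mod_cast (card_erase_add_one hkL).symm
      rw [← add_sum_erase L _ hkL, hc]
      have : chargeWeight m k = m / k - m / (k + 1 : ℕ) := by
        rw [chargeWeight, if_neg (by omega)]
        push_cast
        field_simp
        ring
      have e : ((k + 1 : ℕ) : ℝ) - (#(L.erase k) + 1) = k - #(L.erase k) := by
        push_cast; ring
      rw [e]
      linarith
    · have hsub : L ⊆ Ico m k := by
        intro p hp
        have h1 := mem_Ico.1 (hL hp)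
        have h2 : p ≠ k := fun h => hkL (h ▸ hp)
        exact mem_Ico.2 ⟨h1.1, by omega⟩
      have h := ih _ hsub
      have hc : #L ≤ k - m := by simpa using card_le_card hsub
      have hc' : (#L : ℝ) + m ≤ k := by exact_mod_cast (by omega : #L + m ≤ k)
      have hpos : (0 : ℝ) < k - #L := by linarith
      have key : (m : ℝ) / (((k + 1 : ℕ) : ℝ) - #L) - m / (k + 1 : ℕ)
          ≤ m / (k - #L) - m / k := by
        push_cast
        rw [div_sub_div _ _ (by linarith) (by linarith), div_sub_div _ _ (by linarith) (by linarith)]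
        have e1 : (m : ℝ) * (k + 1) - (k + 1 - #L) * m = m * #L := by ring
        have e2 : (m : ℝ) * k - (k - #L) * m = m * #L := by ring
        rw [e1, e2]
        apply div_le_div_of_nonneg_left (by positivity) (by positivity)
        nlinarith
      linarith

theorem card_perm_rank_lt_mul_card_le {α : Type*} [Fintype α] [LinearOrder α]
    (T : Finset α) {i : α} (hi : i ∈ T) (m : ℕ) :
    #{π : Equiv.Perm α | #{j ∈ T | π i < π j} < m} * #T ≤ m * (Fintype.card α).factorial := by
  have hsymm : ∀ i' ∈ T, #{π : Equiv.Perm α | #{j ∈ T | π i' < π j} < m}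
      = #{π : Equiv.Perm α | #{j ∈ T | π i < π j} < m} := by
    intro i' hi'
    refine card_equiv (Equiv.mulRight (Equiv.swap i i')) fun π => ?_
    have hT : ∀ j, j ∈ T ↔ Equiv.swap i i' j ∈ T := by
      intro j
      rcases eq_or_ne j i with rfl | h1
      · simp [hi, hi']
      rcases eq_or_ne j i' with rfl | h2
      · simp [hi, hi']
      rw [Equiv.swap_apply_of_ne_of_ne h1 h2]
    have : #{j ∈ T | π i' < π j}
        = #{j ∈ T | (π * Equiv.swap i i') i < (π * Equiv.swap i i') j} := by
      refine card_equiv (Equiv.swap i i') fun j => ?_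
      simp [← hT]
    simp [this]
  have hrank : ∀ π : Equiv.Perm α, #{i' ∈ T | #{j ∈ T | π i' < π j} < m} ≤ m := by
    intro π
    conv_rhs => rw [← card_range m]
    refine card_le_card_of_injOn (fun i' => #{j ∈ T | π i' < π j}) ?_ ?_
    · intro i' h
      have h := (mem_filter.1 h).2
      simpa using h
    · have hlt : ∀ a ∈ T, ∀ b ∈ T, π a < π b →
          #{j ∈ T | π b < π j} < #{j ∈ T | π a < π j} := by
        intro a _ b hb hab
        apply card_lt_card
        rw [ssubset_iff_of_subset]
        · exact ⟨b, by simp [hb, hab], by simp⟩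
        · intro j hj
          simp only [mem_filter] at hj ⊢
          exact ⟨hj.1, hab.trans hj.2⟩
      intro a ha b hb hab
      have ha := (mem_filter.1 ha).1
      have hb := (mem_filter.1 hb).1
      dsimp only at hab
      rcases lt_trichotomy (π a) (π b) with h | h | h
      · exact absurd (hlt a ha b hb h) (by omega)
      · exact π.injective h
      · exact absurd (hlt b hb a ha h) (by omega)
  calc _ = ∑ i' ∈ T, #{π : Equiv.Perm α | #{j ∈ T | π i' < π j} < m} := by
        rw [sum_congr rfl hsymm, sum_const, smul_eq_mul, mul_comm]
    _ = ∑ π : Equiv.Perm α, #{i' ∈ T | #{j ∈ T | π i' < π j} < m} := by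
        simp only [card_filter]
        exact sum_comm
    _ ≤ ∑ _π : Equiv.Perm α, m := sum_le_sum fun π _ => hrank π
    _ = _ := by simp [Fintype.card_perm, mul_comm]

theorem card_not_lexGt_lt {n m : ℕ} (hm : 1 ≤ m) (hmn : m < n) {π : Equiv.Perm (Fin n)}
    {i : Fin n} {a : ℝ} {b : Fin n → ℝ}
    (h : n - m ≤ #{j : Fin n | j ≠ i ∧ lexGt π i j a (b j)}) :
    #{j : Fin n | j ≠ i ∧ ¬ lexGt π i j a (b j)} < m := by
  have h1 := card_filter_add_card_filter_not (s := univ.erase i)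
    (fun j => lexGt π i j a (b j))
  have e (p : Fin n → Prop) [DecidablePred p] :
      (univ.erase i).filter p = univ.filter fun j => j ≠ i ∧ p j := by
    ext; simp
  rw [e, e, card_erase_of_mem (mem_univ _), card_univ, Fintype.card_fin] at h1
  omega

theorem not_lexGt_of_lt {n : ℕ} {π : Equiv.Perm (Fin n)} {i j : Fin n} {a b : ℝ}
    (h : a < b) : ¬ lexGt π i j a b := by
  rintro (h' | h')
  · exact absurd h h'.le.not_gt
  · exact absurd h'.1 h.ne

theorem not_lexGt_of_le {n : ℕ} {π : Equiv.Perm (Fin n)} {i j : Fin n} {a b : ℝ}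
    (h : a ≤ b) (hπ : π i < π j) : ¬ lexGt π i j a b := by
  rintro (h' | h')
  · exact absurd h h'.not_ge
  · exact absurd h'.2 hπ.le.not_gt

/-- The number of candidates, summed over all tie-breaking permutations, for fixed rounded
values `g j` and rounded lower estimates `h i j`, with the bidders sorted by `σ`. -/
theorem sum_candidates_le {n m : ℕ} (hm : 1 ≤ m) (hmn : m < n) (g : Fin n → ℝ)
    (h : Fin n → Fin n → ℝ) (σ : Equiv.Perm (Fin n)) (hσ : Antitone (g ∘ σ)) :
    ∑ i : Fin n, ∑ π : Equiv.Perm (Fin n),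
      (if n - m ≤ #{j : Fin n | j ≠ i ∧ lexGt π i j (g i) (h i j)} then (1 : ℝ) else 0)
    ≤ n.factorial * (2 * m + ∑ i : Fin n, ∑ j : Fin n,
      if h i j < g j then chargeWeight m (σ.symm j) else 0) := by
  have hF : (0 : ℝ) < n.factorial := by exact_mod_cast n.factorial_pos
  have hm0 : (0 : ℝ) < m := by exact_mod_cast hm
  set P : Fin n → ℝ := fun i => ∑ π : Equiv.Perm (Fin n),
      (if n - m ≤ #{j : Fin n | j ≠ i ∧ lexGt π i j (g i) (h i j)} then (1 : ℝ) else 0) with hP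
  set W : Fin n → ℝ := fun i => ∑ j : Fin n,
      if h i j < g j then chargeWeight m (σ.symm j) else 0 with hW
  have hterm : ∀ i j, 0 ≤ if h i j < g j then chargeWeight m (σ.symm j) else 0 := by
    intro i j
    split_ifs
    · exact chargeWeight_nonneg _ _
    · exact le_rfl
  have hW0 : ∀ i, 0 ≤ W i := fun i => sum_nonneg fun j _ => hterm i j
  have hP1 : ∀ i, P i ≤ n.factorial := by
    intro i
    calc P i ≤ ∑ _π : Equiv.Perm (Fin n), (1 : ℝ) :=
          sum_le_sum fun π _ => by split_ifs <;> norm_num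
      _ = _ := by simp [Fintype.card_perm]
  have hW1 : ∀ i j, h i j < g j → (σ.symm j : ℕ) < m → 1 ≤ W i := by
    intro i j hij hj
    calc (1 : ℝ) = if h i j < g j then chargeWeight m (σ.symm j) else 0 := by
          simp [hij, chargeWeight, hj]
      _ ≤ W i := single_le_sum (fun j _ => hterm i j) (mem_univ j)
  have hanti : ∀ j k, σ.symm j ≤ σ.symm k → g k ≤ g j := by
    intro j k hjk
    simpa using hσ hjk
  set q : Fin n := σ ⟨m - 1, by omega⟩ with hq
  have hqpos : (σ.symm q : ℕ) = m - 1 := by simp [hq]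
  have htop : ∀ j, (σ.symm j : ℕ) < m → g q ≤ g j := by
    intro j hj
    exact hanti _ _ (by rw [Fin.le_def]; omega)
  have hcardtop : #{j : Fin n | (σ.symm j : ℕ) < m} = m := by
    have : #{j : Fin n | (σ.symm j : ℕ) < m} = #{p : Fin n | (p : ℕ) < m} :=
      card_equiv σ.symm fun j => by simp
    rw [this, Fin.card_filter_val_lt]
    omega
  set C : Finset (Fin n) := {j | g q ≤ g j} with hC
  set U : Finset (Fin n) := {j | g q < g j} with hU
  have hUcard : #U ≤ m := by
    conv_rhs => rw [← hcardtop]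
    apply card_le_card
    intro j hj
    simp only [hU, mem_filter, mem_univ, true_and] at hj ⊢
    by_contra hlt
    exact absurd (hanti q j (by rw [Fin.le_def]; omega)) hj.not_ge
  have hCm : m ≤ #C := by
    conv_lhs => rw [← hcardtop]
    apply card_le_card
    intro j hj
    simp only [hC, mem_filter, mem_univ, true_and] at hj ⊢
    exact htop j hj
  have hC0 : (0 : ℝ) < #C := by exact_mod_cast lt_of_lt_of_le hm hCm
  have hCpos : ∀ j ∈ C, (σ.symm j : ℕ) < #C := by
    intro j hj
    have : #(Iic (σ.symm j)) ≤ #C := by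
      refine card_le_card_of_injOn σ ?_ σ.injective.injOn
      intro p hp
      simp only [coe_Iic, Set.mem_Iic, hC, coe_filter, mem_univ, true_and,
        Set.mem_ofPred_eq, mem_filter] at hp hj ⊢
      exact hj.trans (hanti _ _ (by simpa using hp))
    rw [Fin.card_Iic] at this
    omega
  have hbelow : ∀ i, g i < g q → P i ≤ n.factorial * W i := by
    intro i hi
    by_cases hex : ∃ j, h i j < g j ∧ (σ.symm j : ℕ) < m
    · obtain ⟨j, hj1, hj2⟩ := hex
      nlinarith [hP1 i, hW1 i j hj1 hj2]
    · have : P i = 0 := by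
        refine sum_eq_zero fun π _ => if_neg fun hc => ?_
        have hlt := card_not_lexGt_lt hm hmn hc
        have : #{j : Fin n | (σ.symm j : ℕ) < m}
            ≤ #{j : Fin n | j ≠ i ∧ ¬ lexGt π i j (g i) (h i j)} := by
          apply card_le_card
          intro j hj
          simp only [mem_filter, mem_univ, true_and] at hj ⊢
          have h1 := htop j hj
          have h2 : g j ≤ h i j := by
            by_contra hh
            exact hex ⟨j, not_le.1 hh, hj⟩
          refine ⟨?_, not_lexGt_of_lt (by linarith)⟩
          rintro rfl
          linarith
        omega
      rw [this]
      have := hW0 i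
      positivity
  have htie : ∀ i, g i = g q → P i ≤ n.factorial * (m / #C + W i) := by
    intro i hi
    have hq0 : (0 : ℝ) ≤ m / #C := by positivity
    by_cases hex : ∃ j, h i j < g j ∧ (σ.symm j : ℕ) < m
    · obtain ⟨j, hj1, hj2⟩ := hex
      nlinarith [hP1 i, hW1 i j hj1 hj2]
    · set L : Finset (Fin n) := {j ∈ C | j ≠ i ∧ h i j < g j} with hL
      have hiC : i ∈ C := by simp [hC, hi]
      have hiL : i ∉ L := by simp [hL]
      have hLC : L ⊆ C := filter_subset _ _
      set T : Finset (Fin n) := C \ L with hT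
      have hiT : i ∈ T := by simp [hT, hiC, hiL]
      have hTcard : (#T : ℝ) = #C - #L := by
        rw [hT, card_sdiff_of_subset hLC, Nat.cast_sub (card_le_card hLC)]
      have hT0 : (0 : ℝ) < #T := by exact_mod_cast card_pos.2 ⟨i, hiT⟩
      have hPT : P i * #T ≤ m * n.factorial := by
        have hcount := card_perm_rank_lt_mul_card_le T hiT m
        rw [Fintype.card_fin] at hcount
        have hle : P i ≤ #{π : Equiv.Perm (Fin n) | #{j ∈ T | π i < π j} < m} := by
          rw [card_filter]
          push_cast
          refine sum_le_sum fun π _ => ?_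
          by_cases hc : n - m ≤ #{j : Fin n | j ≠ i ∧ lexGt π i j (g i) (h i j)}
          · have hlt := card_not_lexGt_lt hm hmn hc
            have hsub : #{j ∈ T | π i < π j}
                ≤ #{j : Fin n | j ≠ i ∧ ¬ lexGt π i j (g i) (h i j)} := by
              apply card_le_card
              intro j hj
              simp only [hT, hL, hC, mem_filter, mem_sdiff, mem_univ, true_and] at hj ⊢
              have hji : j ≠ i := by
                rintro rfl
                exact lt_irrefl _ hj.2
              refine ⟨hji, not_lexGt_of_le ?_ hj.2⟩
              have : ¬ h i j < g j := fun hh => hj.1.2 ⟨hj.1.1, hji, hh⟩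
              linarith [hj.1.1]
            rw [if_pos hc, if_pos (by omega)]
          · rw [if_neg hc]
            split_ifs <;> norm_num
        calc P i * #T ≤ #{π : Equiv.Perm (Fin n) | #{j ∈ T | π i < π j} < m} * #T := by
              gcongr
          _ ≤ _ := by exact_mod_cast hcount
      have hLW : ∑ j ∈ L, chargeWeight m (σ.symm j) ≤ W i := by
        calc _ = ∑ j ∈ L, if h i j < g j then chargeWeight m (σ.symm j) else 0 := by
              refine sum_congr rfl fun j hj => ?_
              rw [if_pos (mem_filter.1 hj).2.2]
          _ ≤ W i := sum_le_sum_of_subset_of_nonneg (subset_univ _) fun j _ _ => hterm i j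
      have hinj : Function.Injective fun j : Fin n => (σ.symm j : ℕ) :=
        Fin.val_injective.comp σ.symm.injective
      have hmain := div_card_compl_le hm #C hCm (L.map ⟨_, hinj⟩) (by
        intro p hp
        obtain ⟨j, hj, rfl⟩ := mem_map.1 hp
        have hjL := mem_filter.1 hj
        refine mem_Ico.2 ⟨?_, hCpos j hjL.1⟩
        by_contra hlt
        exact hex ⟨j, hjL.2.2, not_le.1 hlt⟩)
      rw [card_map, sum_map, ← hTcard] at hmain
      have hmain' : (m : ℝ) / #T ≤ m / #C + W i := hmain.trans (by
        simp only [Function.Embedding.coeFn_mk]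
        linarith)
      calc P i ≤ m * n.factorial / #T := by rwa [le_div_iff₀ hT0]
        _ = n.factorial * (m / #T) := by ring
        _ ≤ _ := by gcongr
  have hall : ∀ i, P i ≤ n.factorial *
      ((if i ∈ U then 1 else 0) + (if i ∈ C then (m : ℝ) / #C else 0) + W i) := by
    intro i
    have hq0 : (0 : ℝ) ≤ m / #C := by positivity
    rcases lt_trichotomy (g i) (g q) with hi | hi | hi
    · have h1 : i ∉ U := by simp [hU, hi.le]
      have h2 : i ∉ C := by simp [hC, hi]
      simpa [h1, h2] using hbelow i hi
    · have h1 : i ∉ U := by simp [hU, hi]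
      have h2 : i ∈ C := by simp [hC, hi]
      simpa [h1, h2] using htie i hi
    · have h1 : i ∈ U := by simp [hU, hi]
      have h2 : i ∈ C := by simp [hC, hi.le]
      rw [if_pos h1, if_pos h2]
      nlinarith [hP1 i, hW0 i]
  calc ∑ i, P i ≤ ∑ i, (n.factorial : ℝ) *
        ((if i ∈ U then 1 else 0) + (if i ∈ C then (m : ℝ) / #C else 0) + W i) :=
        sum_le_sum fun i _ => hall i
    _ = n.factorial * (#U + #C * (m / #C) + ∑ i, W i) := by
        rw [← mul_sum, sum_add_distrib, sum_add_distrib]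
        simp
    _ ≤ _ := by
        have : (#C : ℝ) * (m / #C) = m := by field_simp
        rw [this]
        have : (#U : ℝ) ≤ m := by exact_mod_cast hUcard
        gcongr
        linarith

theorem fr_lt_fr_iff (r a b : ℝ) :
    fr r a < fr r b ↔ ⌊Real.logb 2 a - r⌋ < ⌊Real.logb 2 b - r⌋ := by
  unfold fr
  rw [Real.rpow_lt_rpow_left_iff (by norm_num)]
  simp

theorem fr_le_fr {r a b : ℝ} (ha : 0 < a) (hab : a ≤ b) : fr r a ≤ fr r b := by
  unfold fr
  rw [Real.rpow_le_rpow_left_iff (by norm_num)]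
  have : Real.logb 2 a ≤ Real.logb 2 b := Real.logb_le_logb_of_le (by norm_num) ha hab
  have h : ⌊Real.logb 2 a - r⌋ ≤ ⌊Real.logb 2 b - r⌋ := Int.floor_le_floor (by linarith)
  have : (⌊Real.logb 2 a - r⌋ : ℝ) ≤ ⌊Real.logb 2 b - r⌋ := by exact_mod_cast h
  linarith

theorem measurable_fr (w : ℝ) : Measurable fun r => fr r w := by
  unfold fr
  have : Measurable fun r : ℝ => (⌊Real.logb 2 w - r⌋ : ℝ) :=
    measurable_from_top.comp (Int.measurable_floor.comp (measurable_const.sub measurable_id))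
  exact Measurable.pow measurable_const (measurable_id.add this)

theorem volume_floor_sub_lt_le {a b : ℝ} (hab : b < a + 1) :
    volume {r ∈ Set.Ico (0 : ℝ) 1 | ⌊a - r⌋ < ⌊b - r⌋} ≤ ENNReal.ofReal (b - a) := by
  have hc0 : (⌊b⌋ : ℝ) ≤ b := Int.floor_le b
  have hc1 : b < ⌊b⌋ + 1 := Int.lt_floor_add_one b
  have hsub : {r ∈ Set.Ico (0 : ℝ) 1 | ⌊a - r⌋ < ⌊b - r⌋} ⊆
      Set.Icc (max (a - ⌊b⌋) 0) (b - ⌊b⌋) ∪ Set.Icc (a - ⌊b⌋ + 1) 1 := by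
    rintro r ⟨⟨hr0, hr1⟩, hr⟩
    have h1 : a - r < ⌊b - r⌋ := Int.floor_lt.1 hr
    have h2 : (⌊b - r⌋ : ℝ) ≤ b - r := Int.floor_le _
    have h3 : ⌊b - r⌋ ≤ ⌊b⌋ := Int.floor_le_floor (by linarith)
    have h4 : ⌊b⌋ - 2 < ⌊b - r⌋ := by
      have : ((⌊b⌋ - 2 : ℤ) : ℝ) < ⌊b - r⌋ := by push_cast; linarith
      exact_mod_cast this
    rcases (by omega : ⌊b - r⌋ = ⌊b⌋ ∨ ⌊b - r⌋ = ⌊b⌋ - 1) with h | h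
    · left
      rw [h] at h1 h2
      exact ⟨max_le (by linarith) hr0, by linarith⟩
    · right
      rw [h] at h1 h2
      push_cast at h1 h2
      exact ⟨by linarith, hr1.le⟩
  refine (measure_mono hsub).trans ((measure_union_le _ _).trans ?_)
  rw [Real.volume_Icc, Real.volume_Icc]
  rcases le_total 0 (a - ⌊b⌋) with h | h
  · rw [max_eq_left h, ENNReal.ofReal_of_nonpos (p := 1 - (a - ⌊b⌋ + 1)) (by linarith), add_zero]
    exact ENNReal.ofReal_le_ofReal (by linarith)
  · rw [max_eq_right h, ← ENNReal.ofReal_add (by linarith) (by linarith)]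
    exact ENNReal.ofReal_le_ofReal (by linarith)

theorem neg_logb_two_le {y : ℝ} (hy : 1 / 2 ≤ y) (hy1 : y ≤ 1) :
    -Real.logb 2 y ≤ 2 * (1 - y) := by
  have h := strictConcaveOn_log_Ioi.concaveOn.2 (Set.mem_Ioi.2 (by norm_num : (0 : ℝ) < 1 / 2))
    (Set.mem_Ioi.2 one_pos) (by linarith : 0 ≤ 2 - 2 * y) (by linarith : 0 ≤ 2 * y - 1) (by ring)
  have e : (2 - 2 * y) • (1 / 2 : ℝ) + (2 * y - 1) • (1 : ℝ) = y := by
    simp only [smul_eq_mul]; ring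
  rw [e] at h
  simp only [one_div, Real.log_inv, Real.log_one, smul_eq_mul] at h
  have h2 : 0 < Real.log 2 := Real.log_pos (by norm_num)
  rw [Real.logb, ← neg_div, div_le_iff₀ h2]
  linarith

theorem volume_fr_lt_le {l w : ℝ} (hl : 0 < l) (hlw : l ≤ w) :
    (volume {r ∈ Set.Ico (0 : ℝ) 1 | fr r l < fr r w}).toReal ≤ 2 * (1 - l / w) := by
  have hw : 0 < w := hl.trans_le hlw
  have hy1 : l / w ≤ 1 := (div_le_one hw).2 hlw
  refine ENNReal.toReal_le_of_le_ofReal (by linarith) ?_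
  rcases le_or_gt (l / w) (1 / 2) with h | h
  · calc _ ≤ volume (Set.Ico (0 : ℝ) 1) := measure_mono fun r hr => hr.1
      _ = ENNReal.ofReal 1 := by simp
      _ ≤ _ := ENNReal.ofReal_le_ofReal (by linarith)
  · have hlog : -Real.logb 2 (l / w) = Real.logb 2 w - Real.logb 2 l := by
      rw [Real.logb_div hl.ne' hw.ne']; ring
    have hb := neg_logb_two_le h.le hy1
    rw [hlog] at hb
    simp only [fr_lt_fr_iff]
    refine (volume_floor_sub_lt_le ?_).trans
      (ENNReal.ofReal_le_ofReal hb)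
    linarith

theorem lowEst_le {n : ℕ} {S : Fin n → Type*} [∀ i, Nonempty (S i)]
    {v : ((i : Fin n) → S i) → ℝ} (hv : ∀ s, 0 ≤ v s) (s : (i : Fin n) → S i) (i : Fin n) :
    lowEst v s i ≤ v s := by
  refine csInf_le ⟨0, ?_⟩ ⟨s i, by simp⟩
  rintro _ ⟨o, rfl⟩
  exact hv _

theorem measurableSet_isCandidateMulti {n : ℕ} {S : Fin n → Type*} [∀ i, Nonempty (S i)]
    (m : ℕ) (v : Fin n → ((i : Fin n) → S i) → ℝ) (s : (i : Fin n) → S i)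
    (π : Equiv.Perm (Fin n)) (i : Fin n) :
    MeasurableSet {r : ℝ | IsCandidateMulti m v s r π i} := by
  unfold IsCandidateMulti
  simp only [card_filter]
  refine measurableSet_le measurable_const (Finset.measurable_fun_sum _ fun j _ => ?_)
  refine Measurable.ite ?_ measurable_const measurable_const
  refine (MeasurableSet.const _).inter ?_
  refine (measurableSet_lt (measurable_fr _) (measurable_fr _)).union ?_
  exact (measurableSet_eq_fun (measurable_fr _) (measurable_fr _)).inter (MeasurableSet.const _)

theorem setIntegral_Ico_ite {p : ℝ → Prop} [DecidablePred p] (hp : MeasurableSet {r | p r})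
    (c : ℝ) :
    IntegrableOn (fun r => if p r then c else 0) (Set.Ico 0 1) ∧
    ∫ r in Set.Ico (0 : ℝ) 1, (if p r then c else 0)
      = (volume {r ∈ Set.Ico (0 : ℝ) 1 | p r}).toReal * c := by
  have e : (fun r => if p r then c else 0) = Set.indicator {r | p r} fun _ => c := by
    ext r
    simp [Set.indicator_apply]
  rw [e]
  constructor
  · exact (integrableOn_const (by simp)).indicator hp
  · rw [setIntegral_indicator hp, setIntegral_const, smul_eq_mul]
    rfl

/-- Fractional feasibility of the adjusted Randomized Candidate Filtering mechanism
for `m` identical items: the expected number of candidates is at most `4m(d+1)`,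
hence the allocation probabilities `x_i = E[c_i]/(4(d+1))` sum to at most `m`. -/
theorem adjusted_rcf_fractional_feasibility {n : ℕ} {S : Fin n → Type*}
    [∀ i, Nonempty (S i)]
    (m : ℕ) (hm : 1 ≤ m) (hmn : m < n)
    (d : ℕ) (v : Fin n → ((i : Fin n) → S i) → ℝ)
    (hnonneg : ∀ j s, 0 ≤ v j s)
    (hsb : ∀ (j : Fin n) (s : (i : Fin n) → S i),
      ∑ i : Fin n, (v j s - lowEst (v j) s i) ≤ (d : ℝ) * v j s)
    (s : (i : Fin n) → S i)
    (hpos : ∀ i, 0 < v i s)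
    (hlowpos : ∀ j i, 0 < lowEst (v j) s i) :
    (∑ i : Fin n, EcandMulti m v s i ≤ 4 * (m : ℝ) * ((d : ℝ) + 1)) ∧
    (∑ i : Fin n, EcandMulti m v s i / (4 * ((d : ℝ) + 1)) ≤ (m : ℝ)) := by
  have hF : (0 : ℝ) < n.factorial := by exact_mod_cast n.factorial_pos
  have hm1 : (1 : ℝ) ≤ m := by exact_mod_cast hm
  have hd0 : (0 : ℝ) ≤ d := Nat.cast_nonneg d
  set σ : Equiv.Perm (Fin n) := Tuple.sort fun j => -v j s with hσ
  have hsort : ∀ r, Antitone ((fun j => fr r (v j s)) ∘ σ) := by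
    intro r p q hpq
    have := Tuple.monotone_sort (fun j => -v j s) hpq
    exact fr_le_fr (hpos _) (neg_le_neg_iff.1 this)
  have hcand := fun π i => setIntegral_Ico_ite (measurableSet_isCandidateMulti m v s π i) 1
  have hlow := fun i j => setIntegral_Ico_ite
    (measurableSet_lt (measurable_fr (lowEst (v j) s i)) (measurable_fr (v j s)))
    (chargeWeight m (σ.symm j))
  have hint := setIntegral_mono (μ := volume) (s := Set.Ico (0 : ℝ) 1)
    (f := fun r => ∑ i : Fin n, ∑ π : Equiv.Perm (Fin n),
      if IsCandidateMulti m v s r π i then (1 : ℝ) else 0)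
    (g := fun r => n.factorial * (2 * m + ∑ i : Fin n, ∑ j : Fin n,
      if fr r (lowEst (v j) s i) < fr r (v j s) then chargeWeight m (σ.symm j) else 0))
    (integrable_finsetSum _ fun i _ => integrable_finsetSum _ fun π _ => (hcand π i).1)
    (((integrableOn_const (by simp)).add
      (integrable_finsetSum _ fun i _ => integrable_finsetSum _ fun j _ => (hlow i j).1)).const_mul _)
    (fun r => sum_candidates_le hm hmn (fun j => fr r (v j s))
      (fun i j => fr r (lowEst (v j) s i)) σ (hsort r))
  rw [integral_finsetSum _ fun i _ => integrable_finsetSum _ fun π _ => (hcand π i).1,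
    integral_const_mul, integral_add (integrable_const _)
      (integrable_finsetSum _ fun i _ => integrable_finsetSum _ fun j _ => (hlow i j).1),
    integral_finsetSum _ fun i _ => integrable_finsetSum _ fun j _ => (hlow i j).1,
    setIntegral_const] at hint
  simp_rw [integral_finsetSum _ fun π _ => (hcand π _).1,
    integral_finsetSum _ fun j _ => (hlow _ j).1, fun π i => (hcand π i).2,
    fun i j => (hlow i j).2] at hint
  have hcharge : ∑ i : Fin n, ∑ j : Fin n,
      (volume {r ∈ Set.Ico (0 : ℝ) 1 | fr r (lowEst (v j) s i) < fr r (v j s)}).toReal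
        * chargeWeight m (σ.symm j) ≤ 2 * d * (m + 1) := by
    rw [sum_comm]
    calc _ ≤ ∑ j : Fin n, 2 * d * chargeWeight m (σ.symm j) := by
          refine sum_le_sum fun j _ => ?_
          rw [← sum_mul]
          refine mul_le_mul_of_nonneg_right ?_ (chargeWeight_nonneg _ _)
          calc _ ≤ ∑ i : Fin n, 2 * (1 - lowEst (v j) s i / v j s) :=
                sum_le_sum fun i _ => volume_fr_lt_le (hlowpos j i) (lowEst_le (hnonneg j) s i)
            _ = 2 * ((∑ i : Fin n, (v j s - lowEst (v j) s i)) / v j s) := by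
                rw [← mul_sum, sum_div]
                congr 1
                refine sum_congr rfl fun i _ => ?_
                rw [sub_div, div_self (hpos j).ne']
            _ ≤ 2 * d := by
                have := (div_le_iff₀ (hpos j)).2 (hsb j s)
                linarith
      _ = 2 * d * ∑ p ∈ range n, chargeWeight m p := by
          rw [← mul_sum, Equiv.sum_comp σ.symm fun p : Fin n => chargeWeight m p,
            Fin.sum_univ_eq_sum_range]
      _ ≤ _ := by
          have := sum_range_chargeWeight_le hm hmn.le
          have h0 : (0 : ℝ) ≤ m / n := by positivity
          gcongr
          linarith
  have hmain : ∑ i : Fin n, EcandMulti m v s i ≤ 4 * (m : ℝ) * ((d : ℝ) + 1) := by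
    unfold EcandMulti
    rw [← mul_sum, inv_mul_le_iff₀ hF]
    simp only [mul_one, one_mul, Real.volume_real_Ico, sub_zero, smul_eq_mul,
      max_eq_left zero_le_one] at hint
    refine hint.trans (mul_le_mul_of_nonneg_left ?_ hF.le)
    nlinarith [mul_le_mul_of_nonneg_left hm1 hd0]
  refine ⟨hmain, ?_⟩
  rw [← sum_div, div_le_iff₀ (by positivity)]
  linarith
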